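/- Let p be an odd prime and n ≥ 0 an integer. A unit u of the p-adic integers Z_p is a p^n-th power in the unit group Z_p^× if and only if u^(p−1) ≡ 1 (mod p^(n+1) Z_p). -/

import Mathlib

open Polynomial in
/-- If `p` is odd and `w ≡ 1` modulo `p ^ 2`, then `w` is the `p`-th power of some `z ≡ 1`
modulo `p`. -/
theorem PadicInt.exists_pow_prime_eq {p : ℕ} [Fact p.Prime] (hp : Odd p) {w : ℤ_[p]}
    (hw : (p : ℤ_[p]) ^ 2 ∣ w - 1) : ∃ z : ℤ_[p], z ^ p = w ∧ (p : ℤ_[p]) ∣ z - 1 := by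
  have hp' : p.Prime := Fact.out
  obtain ⟨t, ht⟩ := hw
  have hp3 : 3 ≤ p := by
    have := hp'.two_le
    obtain ⟨m, rfl⟩ := hp
    omega
  obtain ⟨y, hy⟩ := ZMod.exists_one_add_mul_pow_prime_eq (R := ℤ_[p]) hp' (dvd_refl (p : ℤ_[p]))
    (by simpa [pow_succ] using pow_dvd_pow (p : ℤ_[p]) hp3) t
  set a : ℤ_[p] := 1 + p * t with ha_def
  have hpa : (p : ℤ_[p]) ∣ a - 1 := ⟨t, by rw [ha_def]; ring⟩
  have ha : ‖a‖ = 1 := by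
    have hlt : ‖(p : ℤ_[p]) * t‖ < 1 := (PadicInt.norm_lt_one_iff_dvd _).2 ⟨t, rfl⟩
    rw [ha_def, PadicInt.norm_add_eq_max_of_ne (by rw [norm_one]; exact hlt.ne'), norm_one,
      max_eq_left hlt.le]
  have hF : aeval a (X ^ p - C w : ℤ_[p][X]) = (p : ℤ_[p]) ^ 3 * y := by
    have : w = 1 + p ^ 2 * t := by rw [← ht]; ring
    simp [hy, this]
    ring
  have hF' : ‖aeval a (derivative (X ^ p - C w : ℤ_[p][X]))‖ = (p : ℝ)⁻¹ := by
    simp [ha, derivative_X_pow]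
  have hpR : (1 : ℝ) < p := by exact_mod_cast hp'.one_lt
  have hinv : (p : ℝ)⁻¹ < 1 := inv_lt_one_of_one_lt₀ hpR
  have hpos : 0 < (p : ℝ)⁻¹ := by positivity
  obtain ⟨z, hz, hza, -, -⟩ := hensels_lemma (p := p) (F := (X ^ p - C w : ℤ_[p][X])) (a := a) (by
    rw [hF, hF', norm_mul, norm_pow, PadicInt.norm_p]
    calc ((p : ℝ)⁻¹) ^ 3 * ‖y‖ ≤ ((p : ℝ)⁻¹) ^ 3 * 1 := by
          gcongr
          exact PadicInt.norm_le_one y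
      _ < ((p : ℝ)⁻¹) ^ 2 := by
          rw [mul_one]
          exact pow_lt_pow_right_of_lt_one₀ hpos hinv (by norm_num))
  refine ⟨z, by simpa [sub_eq_zero] using hz, ?_⟩
  rw [hF'] at hza
  have hpz := (PadicInt.norm_lt_one_iff_dvd _).1 (hza.trans hinv)
  simpa using dvd_add hpz hpa

/-- For odd `p`, if `z ≡ 1` modulo `p` and `z ^ p ≡ 1` modulo `p ^ (k + 1)`, then `z ≡ 1`
modulo `p ^ k`. -/
theorem PadicInt.pow_dvd_sub_one_of_pow_dvd_pow_prime_sub_one {p : ℕ} [Fact p.Prime] (hp : Odd p)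
    {z : ℤ_[p]} {k : ℕ} (hz : (p : ℤ_[p]) ∣ z - 1)
    (h : (p : ℤ_[p]) ^ (k + 1) ∣ z ^ p - 1) : (p : ℤ_[p]) ^ k ∣ z - 1 := by
  obtain ⟨s, hs⟩ := hz
  obtain ⟨c, hc⟩ := odd_sq_dvd_geom_sum₂_sub (R := ℤ_[p]) 1 s hp
  have hz1 : z = 1 + p * s := by rw [← hs]; ring
  have hprime : Prime (p : ℤ_[p]) := PadicInt.prime_p
  have hfactor : z ^ p - 1 = p * ((z - 1) * (1 + p * c)) := by
    have hgeom := geom_sum₂_mul z 1 p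
    rw [← hz1, one_pow, mul_one, sub_eq_iff_eq_add] at hc
    rw [hc, one_pow] at hgeom
    rw [← hgeom]
    ring
  rw [hfactor, pow_succ', mul_dvd_mul_iff_left hprime.ne_zero] at h
  refine hprime.pow_dvd_of_dvd_mul_right k (fun hd ↦ hprime.not_isUnit ?_) h
  exact isUnit_of_dvd_one ((dvd_add_left (dvd_mul_right _ c)).1 hd)

theorem PadicInt.exists_pow_prime_pow_eq {p : ℕ} [Fact p.Prime] (hp : Odd p) (n : ℕ) :
    ∀ {w : ℤ_[p]}, (p : ℤ_[p]) ^ (n + 1) ∣ w - 1 → ∃ z : ℤ_[p], z ^ p ^ n = w := by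
  induction n with
  | zero => exact fun {w} _ ↦ ⟨w, by simp⟩
  | succ n ih =>
    intro w hw
    obtain ⟨y, rfl, hy⟩ := PadicInt.exists_pow_prime_eq hp ((pow_dvd_pow _ (by omega)).trans hw)
    obtain ⟨z, rfl⟩ := ih (PadicInt.pow_dvd_sub_one_of_pow_dvd_pow_prime_sub_one hp hy hw)
    exact ⟨z, by rw [pow_succ, pow_mul]⟩

theorem PadicInt.dvd_units_pow_sub_one {p : ℕ} [Fact p.Prime] (v : ℤ_[p]ˣ) :
    (p : ℤ_[p]) ∣ (v : ℤ_[p]) ^ (p - 1) - 1 := by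
  rw [← Ideal.mem_span_singleton, ← PadicInt.maximalIdeal_eq_span_p, ← PadicInt.ker_toZMod,
    RingHom.mem_ker, map_sub, map_pow, map_one, sub_eq_zero]
  exact ZMod.pow_card_sub_one_eq_one (v.isUnit.map PadicInt.toZMod).ne_zero

/-- Let `p` be an odd prime and `n ≥ 0`. A unit `u` of `ℤ_p` is a
`p^n`-th power in `ℤ_pˣ` if and only if `u ^ (p - 1) ≡ 1 (mod p^(n+1))`. -/
theorem paper_padic_unit_power_iff (p : ℕ) [Fact p.Prime] (hp : Odd p) (n : ℕ)
    (u : ℤ_[p]ˣ) :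
    (∃ v : ℤ_[p]ˣ, v ^ p ^ n = u) ↔
      ((p : ℤ_[p]) ^ (n + 1)) ∣ ((u : ℤ_[p]) ^ (p - 1) - 1) := by
  have hp' : p.Prime := Fact.out
  constructor
  · rintro ⟨v, rfl⟩
    have h := dvd_sub_pow_of_dvd_sub (PadicInt.dvd_units_pow_sub_one v) n
    rw [one_pow, ← pow_mul, mul_comm, pow_mul] at h
    simpa using h
  · intro h
    obtain ⟨z, hz⟩ := PadicInt.exists_pow_prime_pow_eq hp n h
    have hzu : IsUnit z := by
      rw [← isUnit_pow_iff (pow_ne_zero n hp'.ne_zero), hz]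
      exact u.isUnit.pow _
    obtain ⟨v, rfl⟩ := hzu
    have hv : v ^ p ^ n = u ^ (p - 1) := by
      apply Units.ext
      simpa using hz
    have hcop : IsCoprime ((p - 1 : ℕ) : ℤ) ((p ^ n : ℕ) : ℤ) := by
      rw [Nat.isCoprime_iff_coprime]
      apply Nat.Coprime.pow_right
      exact (Nat.coprime_self_sub_left hp'.one_le).2 (Nat.coprime_one_left p)
    obtain ⟨a, b, hab⟩ := hcop
    refine ⟨v ^ a * u ^ b, ?_⟩
    calc (v ^ a * u ^ b) ^ p ^ n = (v ^ p ^ n) ^ a * (u ^ p ^ n) ^ b := by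
          rw [mul_pow, ← zpow_natCast, ← zpow_natCast, zpow_comm, zpow_comm u b,
            zpow_natCast, zpow_natCast]
      _ = u ^ (a * ((p - 1 : ℕ) : ℤ) + b * ((p ^ n : ℕ) : ℤ)) := by
          rw [hv, zpow_add, mul_comm a, mul_comm b, zpow_mul, zpow_mul, zpow_natCast, zpow_natCast]
      _ = u := by rw [hab, zpow_one]
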